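/- Let k ≥ 1, a ≥ 1, b ≥ 0 and c ≥ 1 be integers, d := gcd(a, b), a' := a/d, and let p be an odd prime with p | c·L_k and p ∤ a'. Then the p-adic valuation of the smallest period of g_{k,φ} satisfies: v_p(P_{k,φ}) = v_p(c·L_k) − v_p(L_k) if v_p(k+1) ≥ v_p(L_k) ≥ 1, and v_p(P_{k,φ}) = v_p(c·L_k) otherwise. -/

import Mathlib

/-- `L k = lcm (1, 2, …, k)`. -/
def Lk (k : ℕ) : ℕ := (Finset.Icc 1 k).lcm id

/-- `g_{k,φ} (n) = (∏_{i=0}^{k} φ (b + a (n + i c))) / φ (lcm_{0 ≤ i ≤ k} (b + a (n + i c)))`. -/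
def gkphi (k a b c n : ℕ) : ℚ :=
  (∏ i ∈ Finset.range (k + 1), ((b + a * (n + i * c)).totient : ℚ)) /
    (((Finset.range (k + 1)).lcm fun i => b + a * (n + i * c)).totient : ℚ)

open Finset in
/-- The local analogue of `gkphi`: `(∏_{i ≤ k} ψ (e i)) / ψ (max_{i ≤ k} e i)`. -/
def localRatio (k : ℕ) (ψ e : ℕ → ℕ) : ℚ :=
  (∏ i ∈ range (k + 1), (ψ (e i) : ℚ)) / (ψ ((range (k + 1)).sup e) : ℚ)

theorem factorization_finset_lcm {ι : Type*} (s : Finset ι) (f : ι → ℕ) (q : ℕ)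
    (hf : ∀ i ∈ s, f i ≠ 0) :
    (s.lcm f).factorization q = s.sup fun i => (f i).factorization q := by
  classical
  induction s using Finset.induction_on with
  | empty => simp
  | insert i s hi ih =>
    have hs : ∀ j ∈ s, f j ≠ 0 := fun j hj => hf j (Finset.mem_insert_of_mem hj)
    have h0 : s.lcm f ≠ 0 := by
      rw [Ne, Finset.lcm_eq_zero_iff]
      rintro ⟨j, hj, h⟩
      exact hs j hj h
    rw [Finset.lcm_insert, Finset.sup_insert, ← ih hs]
    change (Nat.lcm (f i) (s.lcm f)).factorization q = _
    rw [Nat.factorization_lcm (hf i (Finset.mem_insert_self i s)) h0]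
    rfl

theorem totient_eq_prod_of_primeFactors_subset {m : ℕ} (hm : m ≠ 0) {S : Finset ℕ}
    (hS : m.primeFactors ⊆ S) :
    m.totient = ∏ q ∈ S, (q ^ m.factorization q).totient := by
  rw [Nat.totient_eq_prod_factorization hm, Finsupp.prod,
    Nat.support_factorization]
  rw [← Finset.prod_subset hS]
  · refine Finset.prod_congr rfl fun q hq => ?_
    have hqp := Nat.prime_of_mem_primeFactors hq
    rw [Nat.totient_prime_pow hqp
      (hqp.factorization_pos_of_dvd hm (Nat.dvd_of_mem_primeFactors hq))]
  · intro q _ hq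
    rw [← Nat.support_factorization, Finsupp.notMem_support_iff] at hq
    simp [hq]

theorem min_factorization_le_of_modEq {q N x y : ℕ} (hq : q.Prime) (hy : y ≠ 0)
    (h : x ≡ y [MOD q ^ N]) :
    min (x.factorization q) N ≤ min (y.factorization q) N := by
  refine le_min ?_ (min_le_right _ _)
  rw [← hq.pow_dvd_iff_le_factorization hy]
  refine (h.dvd_iff (pow_dvd_pow q (min_le_right _ _))).1 ?_
  exact (pow_dvd_pow q (min_le_left _ _)).trans (Nat.ordProj_dvd x q)

theorem min_factorization_eq_of_modEq {q N x y : ℕ} (hq : q.Prime) (hx : x ≠ 0) (hy : y ≠ 0)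
    (h : x ≡ y [MOD q ^ N]) :
    min (x.factorization q) N = min (y.factorization q) N :=
  le_antisymm (min_factorization_le_of_modEq hq hy h) (min_factorization_le_of_modEq hq hx h.symm)

theorem exists_pos_mul_modEq {u Q : ℕ} (hQ : 0 < Q) (h : u.Coprime Q) (z : ℕ) :
    ∃ n, 0 < n ∧ u * n ≡ z [MOD Q] := by
  obtain ⟨m, -, hm⟩ := Nat.exists_mul_mod_eq_of_coprime z h hQ.ne'
  refine ⟨m + Q, by omega, ?_⟩
  rw [mul_add]
  exact (Nat.ModEq.add hm (Nat.modEq_zero_iff_dvd.2 (dvd_mul_left Q u))).trans (by rfl)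

theorem gkphi_eq_prod_localRatio {k a b c n : ℕ} (ha : 1 ≤ a) (hn : 0 < n) {S : Finset ℕ}
    (hS : ∀ i ∈ Finset.range (k + 1), (b + a * (n + i * c)).primeFactors ⊆ S) :
    gkphi k a b c n = ∏ q ∈ S, localRatio k (fun e => (q ^ e).totient)
      (fun i => (b + a * (n + i * c)).factorization q) := by
  have hx : ∀ i ∈ Finset.range (k + 1), b + a * (n + i * c) ≠ 0 := fun i _ => by positivity
  have h0 : ((Finset.range (k + 1)).lcm fun i => b + a * (n + i * c)) ≠ 0 := by
    rw [Ne, Finset.lcm_eq_zero_iff]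
    rintro ⟨j, hj, h⟩
    exact hx j hj h
  have hlS : ((Finset.range (k + 1)).lcm fun i => b + a * (n + i * c)).primeFactors ⊆ S := by
    intro q hq
    have hq' : 0 < ((Finset.range (k + 1)).lcm fun i => b + a * (n + i * c)).factorization q :=
      (Nat.prime_of_mem_primeFactors hq).factorization_pos_of_dvd h0
        (Nat.dvd_of_mem_primeFactors hq)
    rw [factorization_finset_lcm _ _ _ hx, Finset.lt_sup_iff] at hq'
    obtain ⟨i, hi, h⟩ := hq'
    refine hS i hi ?_
    rw [← Nat.support_factorization, Finsupp.mem_support_iff]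
    exact h.ne'
  unfold gkphi localRatio
  rw [Finset.prod_div_distrib, totient_eq_prod_of_primeFactors_subset h0 hlS, Finset.prod_comm]
  push_cast
  congr 1
  · refine Finset.prod_congr rfl fun i hi => ?_
    rw [totient_eq_prod_of_primeFactors_subset (hx i hi) (hS i hi)]
    push_cast
    rfl
  · refine Finset.prod_congr rfl fun q _ => ?_
    rw [factorization_finset_lcm _ _ _ hx]

theorem localRatio_min_eq {k N : ℕ} {ψ e : ℕ → ℕ} (hψ : ∀ j, ψ j ≠ 0)
    (h : ∀ i ∈ Finset.range (k + 1), ∀ j ∈ Finset.range (k + 1), i ≠ j → min (e i) (e j) ≤ N) :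
    localRatio k ψ (fun i => min (e i) N) = localRatio k ψ e := by
  obtain ⟨j, hj, hje⟩ :=
    Finset.exists_mem_eq_sup (Finset.range (k + 1)) Finset.nonempty_range_add_one e
  have hle : ∀ i ∈ Finset.range (k + 1), e i ≤ e j := fun i hi => hje ▸ Finset.le_sup hi
  have hsup : ((Finset.range (k + 1)).sup fun i => min (e i) N) = min (e j) N := by
    refine le_antisymm (Finset.sup_le fun i hi => min_le_min_right _ (hle i hi)) ?_
    exact Finset.le_sup (f := fun i => min (e i) N) hj
  unfold localRatio
  rw [hsup, hje, ← Finset.mul_prod_erase _ _ hj, ← Finset.mul_prod_erase _ _ hj,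
    mul_div_cancel_left₀ _ (by exact_mod_cast hψ _), mul_div_cancel_left₀ _ (by exact_mod_cast hψ _)]
  refine Finset.prod_congr rfl fun i hi => ?_
  have h1 := h i (Finset.mem_of_mem_erase hi) j hj (Finset.ne_of_mem_erase hi)
  have h2 := hle i (Finset.mem_of_mem_erase hi)
  simp only
  rw [min_eq_left (by omega)]

theorem localRatio_comp_add {k : ℕ} {ψ e : ℕ → ℕ} (he : ∀ i, e (i + (k + 1)) = e i) (r : ℕ) :
    localRatio k ψ (fun i => e (i + r)) = localRatio k ψ e := by
  induction r with
  | zero => rfl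
  | succ r ih =>
    rw [← ih]
    have h0 : e (k + (r + 1)) = e (0 + r) := by
      rw [← he (0 + r)]
      congr 1
      omega
    unfold localRatio
    congr 1
    · rw [Finset.prod_range_succ, Finset.prod_range_succ']
      simp only
      rw [h0]
      refine congrArg (· * _) (Finset.prod_congr rfl fun i _ => ?_)
      congr 3
      omega
    · congr 2
      refine le_antisymm (Finset.sup_le fun i hi => ?_) (Finset.sup_le fun i hi => ?_)
      · rw [Finset.mem_range] at hi
        rcases Nat.lt_or_ge i k with h | h
        · refine le_trans (le_of_eq ?_) (Finset.le_sup (f := fun i => e (i + r))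
            (Finset.mem_range.2 (show i + 1 < k + 1 by omega)))
          congr 1
          omega
        · obtain rfl : i = k := by omega
          rw [h0]
          exact Finset.le_sup (f := fun i => e (i + r)) (Finset.mem_range.2 (by omega))
      · rw [Finset.mem_range] at hi
        rcases Nat.eq_zero_or_pos i with rfl | h
        · rw [← h0]
          exact Finset.le_sup (f := fun i => e (i + (r + 1))) (Finset.mem_range.2 (by omega))
        · refine le_trans (le_of_eq ?_) (Finset.le_sup (f := fun i => e (i + (r + 1)))
            (Finset.mem_range.2 (show i - 1 < k + 1 by omega)))
          congr 1
          omega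

theorem localRatio_ne_zero {k : ℕ} {ψ e : ℕ → ℕ} (hψ : ∀ j, ψ j ≠ 0) : localRatio k ψ e ≠ 0 :=
  div_ne_zero (Finset.prod_ne_zero_iff.2 fun _ _ => by exact_mod_cast hψ _)
    (by exact_mod_cast hψ _)

theorem totient_prime_pow_eq {p : ℕ} (hp : p.Prime) (e : ℕ) :
    (p ^ e).totient = p ^ (e - 1) * (p - 1) ^ min e 1 := by
  rcases Nat.eq_zero_or_pos e with rfl | h
  · simp
  · rw [Nat.totient_prime_pow hp h, min_eq_right h, pow_one]

theorem add_eq_add_of_pow_mul_pow_eq {p : ℕ} (hp : p.Prime) (h2 : p ≠ 2) {x y x' y' : ℕ}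
    (h : p ^ x * (p - 1) ^ y = p ^ x' * (p - 1) ^ y') : x + y = x' + y' := by
  have h3 : 2 < p := lt_of_le_of_ne hp.two_le h2.symm
  have hnd : ¬ p ∣ p - 1 := fun hd => by
    have := Nat.le_of_dvd (by omega) hd
    omega
  have hv : ∀ z, ((p - 1) ^ z).factorization p = 0 := fun z => by
    rw [Nat.factorization_pow, Finsupp.smul_apply, Nat.factorization_eq_zero_of_not_dvd hnd,
      smul_zero]
  have hne : ∀ z, (p - 1) ^ z ≠ 0 := fun z => pow_ne_zero _ (by omega)
  have hf := congrArg (fun m => m.factorization p) h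
  simp only [Nat.factorization_mul (pow_ne_zero _ hp.ne_zero) (hne _), Finsupp.add_apply, hv,
    hp.factorization_pow, Finsupp.single_eq_same, add_zero] at hf
  subst hf
  have := Nat.pow_right_injective (show 2 ≤ p - 1 by omega)
    (Nat.eq_of_mul_eq_mul_left (pow_pos hp.pos _) h)
  rw [this]

open Finset in
theorem sum_add_sup_eq_of_localRatio_eq {p k : ℕ} (hp : p.Prime) (h2 : p ≠ 2) {e e' : ℕ → ℕ}
    (h : localRatio k (fun j => (p ^ j).totient) e = localRatio k (fun j => (p ^ j).totient) e') :
    ∑ i ∈ range (k + 1), e i + (range (k + 1)).sup e' =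
      ∑ i ∈ range (k + 1), e' i + (range (k + 1)).sup e := by
  have hψ : ∀ j, (p ^ j).totient ≠ 0 := fun j => (Nat.totient_pos.2 (pow_pos hp.pos _)).ne'
  unfold localRatio at h
  rw [div_eq_div_iff (by exact_mod_cast hψ _) (by exact_mod_cast hψ _)] at h
  have h' : (∏ i ∈ range (k + 1), (p ^ e i).totient) * (p ^ (range (k + 1)).sup e').totient =
      (∏ i ∈ range (k + 1), (p ^ e' i).totient) * (p ^ (range (k + 1)).sup e).totient := by
    exact_mod_cast h
  simp only [totient_prime_pow_eq hp, prod_mul_distrib, prod_pow_eq_pow_sum] at h'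
  have key := add_eq_add_of_pow_mul_pow_eq hp h2
    (x := ∑ i ∈ range (k + 1), (e i - 1) + ((range (k + 1)).sup e' - 1))
    (y := ∑ i ∈ range (k + 1), min (e i) 1 + min ((range (k + 1)).sup e') 1)
    (x' := ∑ i ∈ range (k + 1), (e' i - 1) + ((range (k + 1)).sup e - 1))
    (y' := ∑ i ∈ range (k + 1), min (e' i) 1 + min ((range (k + 1)).sup e) 1)
    (by simp only [pow_add]; linear_combination h')
  have hs : ∀ f : ℕ → ℕ, ∑ i ∈ range (k + 1), f i =
      ∑ i ∈ range (k + 1), (f i - 1) + ∑ i ∈ range (k + 1), min (f i) 1 := fun f => by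
    rw [← sum_add_distrib]
    exact sum_congr rfl fun i _ => by omega
  rw [hs e, hs e']
  omega

theorem Lk_ne_zero (k : ℕ) : Lk k ≠ 0 := by
  rw [Lk, Ne, Finset.lcm_eq_zero_iff]
  rintro ⟨j, hj, h⟩
  have := (Finset.mem_Icc.1 hj).1
  simp only [id] at h
  omega

theorem pow_factorization_Lk_le {k : ℕ} (q : ℕ) (hk : 1 ≤ k) :
    q ^ (Lk k).factorization q ≤ k := by
  rw [Lk, factorization_finset_lcm _ id _ fun i hi =>
    Nat.one_le_iff_ne_zero.1 (Finset.mem_Icc.1 hi).1]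
  obtain ⟨j, hj, hje⟩ := Finset.exists_mem_eq_sup (Finset.Icc 1 k) ⟨1, Finset.mem_Icc.2 ⟨le_rfl, hk⟩⟩
    fun i => (id i).factorization q
  rw [hje]
  have := Finset.mem_Icc.1 hj
  exact (Nat.le_of_dvd (by omega) (Nat.ordProj_dvd j q)).trans this.2

theorem min_factorization_terms_le {k a b c n q i j : ℕ} (hq : q.Prime) (ha : 1 ≤ a) (hc : 1 ≤ c)
    (hi : i ∈ Finset.range (k + 1)) (hj : j ∈ Finset.range (k + 1)) (hij : i ≠ j) :
    min ((b + a * (n + i * c)).factorization q) ((b + a * (n + j * c)).factorization q) ≤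
      (a * (c * Lk k)).factorization q := by
  wlog hlt : i < j generalizing i j
  · rw [min_comm]
    exact this hj hi hij.symm (by omega)
  rw [Finset.mem_range] at hj
  have hL := Lk_ne_zero k
  obtain ⟨m, rfl⟩ := Nat.exists_eq_add_of_lt hlt
  have hd : q ^ min ((b + a * (n + i * c)).factorization q)
      ((b + a * (n + (i + m + 1) * c)).factorization q) ∣ a * (c * (m + 1)) := by
    have e : b + a * (n + (i + m + 1) * c) = b + a * (n + i * c) + a * (c * (m + 1)) := by ring
    refine (Nat.dvd_add_right ((pow_dvd_pow q (min_le_left _ _)).trans (Nat.ordProj_dvd _ q))).1 ?_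
    refine Dvd.dvd.trans ?_ e.dvd
    exact (pow_dvd_pow q (min_le_right _ _)).trans (Nat.ordProj_dvd _ q)
  have h1 := (hq.pow_dvd_iff_le_factorization (by positivity)).1 hd
  refine h1.trans ((Nat.factorization_le_iff_dvd (by positivity) (by positivity)).2 ?_ q)
  exact mul_dvd_mul_left _ (mul_dvd_mul_left _
    (Finset.dvd_lcm (f := id) (Finset.mem_Icc.2 ⟨by omega, by omega⟩)))

theorem localRatio_terms_add {k a b c n q T : ℕ} {ψ : ℕ → ℕ} (hψ : ∀ j, ψ j ≠ 0)
    (hq : q.Prime) (ha : 1 ≤ a) (hc : 1 ≤ c) (hn : 0 < n) (hT : 0 < T)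
    (h : (c * Lk k).factorization q ≤ T.factorization q) :
    localRatio k ψ (fun i => (b + a * (n + T + i * c)).factorization q) =
      localRatio k ψ (fun i => (b + a * (n + i * c)).factorization q) := by
  have hL := Lk_ne_zero k
  rw [← localRatio_min_eq (N := (a * (c * Lk k)).factorization q) hψ fun i hi j hj hij =>
      min_factorization_terms_le hq ha hc hi hj hij,
    ← localRatio_min_eq (N := (a * (c * Lk k)).factorization q) hψ fun i hi j hj hij =>
      min_factorization_terms_le hq ha hc hi hj hij]
  congr 1
  funext i
  refine min_factorization_eq_of_modEq hq (by positivity) (by positivity) ?_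
  have hd : q ^ (a * (c * Lk k)).factorization q ∣ a * T := by
    rw [hq.pow_dvd_iff_le_factorization (by positivity),
      Nat.factorization_mul (by omega) (by positivity), Nat.factorization_mul (by omega) hT.ne']
    exact Nat.add_le_add_left h _
  have e : b + a * (n + T + i * c) = b + a * (n + i * c) + a * T := by ring
  rw [e]
  exact (Nat.ModEq.add_left _ (Nat.modEq_zero_iff_dvd.2 hd)).trans (by rfl)

theorem localRatio_terms_add_of_le_factorization_succ {k a b c n p T : ℕ} {ψ : ℕ → ℕ}
    (hψ : ∀ j, ψ j ≠ 0)
    (hp : p.Prime) (ha : 1 ≤ a) (hc : 1 ≤ c) (hn : 0 < n)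
    (h : (Lk k).factorization p ≤ (k + 1).factorization p)
    (hT : p ^ c.factorization p ∣ T) :
    localRatio k ψ (fun i => (b + a * (n + T + i * c)).factorization p) =
      localRatio k ψ (fun i => (b + a * (n + i * c)).factorization p) := by
  have hL := Lk_ne_zero k
  have hN : (a * (c * Lk k)).factorization p =
      a.factorization p + (c.factorization p + (Lk k).factorization p) := by
    rw [Nat.factorization_mul (by omega) (by positivity),
      Nat.factorization_mul (by omega) (by omega), Finsupp.add_apply, Finsupp.add_apply]
  obtain ⟨T₁, rfl⟩ := hT
  obtain ⟨r, -, hr⟩ := exists_pos_mul_modEq (pow_pos hp.pos ((Lk k).factorization p))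
    ((Nat.coprime_ordCompl hp (by omega : c ≠ 0)).symm.pow_right _) T₁
  rw [← localRatio_min_eq (N := (a * (c * Lk k)).factorization p) hψ fun i hi j hj hij =>
      min_factorization_terms_le hp ha hc hi hj hij,
    ← localRatio_min_eq (N := (a * (c * Lk k)).factorization p) hψ fun i hi j hj hij =>
      min_factorization_terms_le hp ha hc hi hj hij,
    ← localRatio_comp_add (e := fun i => min ((b + a * (n + i * c)).factorization p) _) _ r]
  · congr 1
    funext i
    refine min_factorization_eq_of_modEq hp (by positivity) (by positivity) ?_
    refine Nat.ModEq.add_left _ ?_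
    have h1 : p ^ c.factorization p * T₁ ≡ r * c
        [MOD p ^ (c.factorization p + (Lk k).factorization p)] := by
      have := (hr.symm.mul_left' (p ^ c.factorization p))
      rw [← pow_add, ← mul_assoc, Nat.ordProj_mul_ordCompl_eq_self, mul_comm c] at this
      exact this
    have h2 := (((h1.add_left n).add_right (i * c)).mul_left' (p ^ a.factorization p)).mul_left
      (a / p ^ a.factorization p)
    rw [← pow_add, ← mul_assoc, ← mul_assoc, mul_comm (a / _),
      Nat.ordProj_mul_ordCompl_eq_self] at h2
    rw [hN]
    refine h2.trans (congrArg (· % _) ?_)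
    ring
  · intro i
    refine min_factorization_eq_of_modEq hp (by positivity) (by positivity) ?_
    have hd : p ^ (a * (c * Lk k)).factorization p ∣ a * ((k + 1) * c) := by
      rw [hp.pow_dvd_iff_le_factorization (by positivity), hN,
        Nat.factorization_mul (by omega) (by positivity),
        Nat.factorization_mul (by omega) (by omega), Finsupp.add_apply, Finsupp.add_apply]
      omega
    have e : b + a * (n + (i + (k + 1)) * c) = b + a * (n + i * c) + a * ((k + 1) * c) := by ring
    rw [e]
    exact (Nat.ModEq.add_left _ (Nat.modEq_zero_iff_dvd.2 hd)).trans (by rfl)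

theorem totient_prime_pow_ne_zero {q : ℕ} (hq : q.Prime) (j : ℕ) : (q ^ j).totient ≠ 0 :=
  (Nat.totient_pos.2 (pow_pos hq.pos _)).ne'

theorem exists_gkphi_eq_prod_localRatio (k a b c n T p : ℕ) (ha : 1 ≤ a) (hn : 0 < n)
    (hp : p.Prime) :
    ∃ S : Finset ℕ, p ∈ S ∧ (∀ q ∈ S, q.Prime) ∧
      gkphi k a b c n = ∏ q ∈ S, localRatio k (fun e => (q ^ e).totient)
        (fun i => (b + a * (n + i * c)).factorization q) ∧
      gkphi k a b c (n + T) = ∏ q ∈ S, localRatio k (fun e => (q ^ e).totient)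
        (fun i => (b + a * (n + T + i * c)).factorization q) := by
  classical
  refine ⟨insert p ((Finset.range (k + 1)).biUnion fun i =>
      (b + a * (n + i * c)).primeFactors ∪ (b + a * (n + T + i * c)).primeFactors),
    Finset.mem_insert_self _ _, ?_, ?_, ?_⟩
  · intro q hq
    simp only [Finset.mem_insert, Finset.mem_biUnion, Finset.mem_union] at hq
    rcases hq with rfl | ⟨i, -, h | h⟩
    · exact hp
    · exact Nat.prime_of_mem_primeFactors h
    · exact Nat.prime_of_mem_primeFactors h
  · refine gkphi_eq_prod_localRatio ha hn fun i hi q hq => Finset.mem_insert_of_mem ?_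
    exact Finset.mem_biUnion.2 ⟨i, hi, Finset.mem_union_left _ hq⟩
  · refine gkphi_eq_prod_localRatio ha (by omega) fun i hi q hq => Finset.mem_insert_of_mem ?_
    exact Finset.mem_biUnion.2 ⟨i, hi, Finset.mem_union_right _ hq⟩

theorem gkphi_add_eq_iff_localRatio {k a b c n p T : ℕ} (ha : 1 ≤ a) (hc : 1 ≤ c) (hn : 0 < n)
    (hT : 0 < T) (hp : p.Prime)
    (h : ∀ q, q.Prime → q ≠ p → (c * Lk k).factorization q ≤ T.factorization q) :
    gkphi k a b c (n + T) = gkphi k a b c n ↔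
      localRatio k (fun e => (p ^ e).totient)
          (fun i => (b + a * (n + T + i * c)).factorization p) =
        localRatio k (fun e => (p ^ e).totient)
          (fun i => (b + a * (n + i * c)).factorization p) := by
  obtain ⟨S, hpS, hS, h1, h2⟩ := exists_gkphi_eq_prod_localRatio k a b c n T p ha hn hp
  rw [h1, h2, ← Finset.mul_prod_erase _ _ hpS, ← Finset.mul_prod_erase _ _ hpS]
  have he : ∏ q ∈ S.erase p, localRatio k (fun e => (q ^ e).totient)
        (fun i => (b + a * (n + T + i * c)).factorization q) =
      ∏ q ∈ S.erase p, localRatio k (fun e => (q ^ e).totient)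
        (fun i => (b + a * (n + i * c)).factorization q) := by
    refine Finset.prod_congr rfl fun q hq => ?_
    have hqp := hS q (Finset.mem_of_mem_erase hq)
    exact localRatio_terms_add (totient_prime_pow_ne_zero hqp) hqp ha hc hn hT
      (h q hqp (Finset.ne_of_mem_erase hq))
  rw [he]
  refine mul_left_inj' (Finset.prod_ne_zero_iff.2 fun q hq => localRatio_ne_zero ?_)
  exact totient_prime_pow_ne_zero (hS q (Finset.mem_of_mem_erase hq))

theorem apply_add_mul_of_period {f : ℕ → ℚ} {P : ℕ} (hP : ∀ n, 0 < n → f (n + P) = f n)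
    (m : ℕ) {n : ℕ} (hn : 0 < n) : f (n + P * m) = f n := by
  induction m generalizing n with
  | zero => simp
  | succ m ih => rw [mul_add, mul_one, ← add_assoc, hP _ (by omega), ih hn]

theorem dvd_of_isLeast_period {f : ℕ → ℚ} {P T : ℕ}
    (hP : IsLeast {T : ℕ | 0 < T ∧ ∀ n : ℕ, 0 < n → f (n + T) = f n} P)
    (hT : ∀ n, 0 < n → f (n + T) = f n) : P ∣ T := by
  by_contra hd
  have hr : 0 < T % P := Nat.pos_of_ne_zero fun h0 => hd (Nat.dvd_of_mod_eq_zero h0)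
  have hle := hP.2 (show T % P ∈ _ from ⟨hr, fun n hn => by
    rw [← apply_add_mul_of_period hP.1.2 (T / P) (by omega : 0 < n + T % P), add_assoc,
       Nat.mod_add_div, hT n hn]⟩)
  exact absurd (Nat.mod_lt T hP.1.1) (by omega)

theorem factorization_le_of_localRatio_periodic {k a b c p T : ℕ} (hk : 1 ≤ k) (ha : 1 ≤ a)
    (hc : 1 ≤ c) (hp : p.Prime) (hodd : p ≠ 2) (hT : 0 < T)
    (hroot : ∀ M, ∃ n, 0 < n ∧ p ^ (a.factorization p + M) ∣ b + a * n)
    (h : ∀ n, 0 < n → localRatio k (fun e => (p ^ e).totient)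
          (fun i => (b + a * (n + T + i * c)).factorization p) =
        localRatio k (fun e => (p ^ e).totient)
          (fun i => (b + a * (n + i * c)).factorization p)) :
    c.factorization p ≤ T.factorization p := by
  by_contra! hlt
  obtain ⟨n, hn, hd⟩ := hroot (c.factorization p)
  have hac : p ^ (a.factorization p + c.factorization p) ∣ a * c :=
    pow_add p _ _ ▸ mul_dvd_mul (Nat.ordProj_dvd a p) (Nat.ordProj_dvd c p)
  have hdi : ∀ i, p ^ (a.factorization p + c.factorization p) ∣ b + a * (n + i * c) := fun i => by
    have e : b + a * (n + i * c) = (b + a * n) + a * c * i := by ring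
    rw [e]
    exact dvd_add hd (hac.mul_right i)
  have hle : ∀ i, a.factorization p + c.factorization p ≤
      (b + a * (n + i * c)).factorization p := fun i =>
    (hp.pow_dvd_iff_le_factorization (by positivity)).1 (hdi i)
  have heq : ∀ i, (b + a * (n + T + i * c)).factorization p =
      a.factorization p + T.factorization p := fun i => by
    have e : b + a * (n + T + i * c) = a * T + (b + a * (n + i * c)) := by ring
    have hm := min_factorization_eq_of_modEq hp (x := b + a * (n + T + i * c)) (y := a * T)
      (N := a.factorization p + c.factorization p) (by positivity) (by positivity)
      (e ▸ (Nat.ModEq.add_left _ (Nat.modEq_zero_iff_dvd.2 (hdi i))).trans (by rfl))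
    rw [Nat.factorization_mul (by omega) (by omega), Finsupp.add_apply] at hm
    omega
  have hs := sum_add_sup_eq_of_localRatio_eq hp hodd (h n hn)
  simp only [heq, Finset.sum_const, Finset.card_range, smul_eq_mul,
    Finset.sup_const Finset.nonempty_range_add_one] at hs
  obtain ⟨j, hj, hje⟩ := Finset.exists_mem_eq_sup (Finset.range (k + 1))
    Finset.nonempty_range_add_one fun i => (b + a * (n + i * c)).factorization p
  rw [hje, ← Finset.add_sum_erase _ _ hj] at hs
  have hsum := Finset.card_nsmul_le_sum ((Finset.range (k + 1)).erase j)
    (fun i => (b + a * (n + i * c)).factorization p) _ fun i _ => hle i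
  rw [Finset.card_erase_of_mem hj, Finset.card_range, smul_eq_mul, Nat.add_sub_cancel] at hsum
  nlinarith

theorem factorization_mul_Lk_le_of_localRatio_periodic {k a b c p T : ℕ} (hk : 1 ≤ k) (ha : 1 ≤ a)
    (hc : 1 ≤ c) (hp : p.Prime) (hodd : p ≠ 2) (hT : 0 < T)
    (hroot : ∀ M, ∃ n, 0 < n ∧ p ^ (a.factorization p + M) ∣ b + a * n)
    (hlt : (k + 1).factorization p < (Lk k).factorization p)
    (h : ∀ n, 0 < n → localRatio k (fun e => (p ^ e).totient)
          (fun i => (b + a * (n + T + i * c)).factorization p) =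
        localRatio k (fun e => (p ^ e).totient)
          (fun i => (b + a * (n + i * c)).factorization p)) :
    c.factorization p + (Lk k).factorization p ≤ T.factorization p := by
  have hγ := factorization_le_of_localRatio_periodic hk ha hc hp hodd hT hroot h
  by_contra! hlt'
  have hL := Lk_ne_zero k
  set N := (a * (c * Lk k)).factorization p with hNdef
  have hN : N = a.factorization p + (c.factorization p + (Lk k).factorization p) := by
    rw [hNdef, Nat.factorization_mul (by omega) (by positivity),
      Nat.factorization_mul (by omega) (by omega), Finsupp.add_apply, Finsupp.add_apply]
  have hac : p ^ (a.factorization p + c.factorization p) ∣ a * c :=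
    pow_add p _ _ ▸ mul_dvd_mul (Nat.ordProj_dvd a p) (Nat.ordProj_dvd c p)
  have hsup : ∀ n, 0 < n → p ^ (a.factorization p + c.factorization p) ∣ b + a * n →
      ((Finset.range (k + 1)).sup fun i => min ((b + a * (n + i * c)).factorization p) N) = N := by
    intro n hn ⟨z, hz⟩
    obtain ⟨u, hu⟩ := hac
    have hcop : u.Coprime (p ^ (Lk k).factorization p) := by
      refine (Nat.Coprime.pow_left _ ((Nat.Prime.coprime_iff_not_dvd hp).2 fun hdu => ?_)).symm
      obtain ⟨u', rfl⟩ := hdu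
      have hd : p ^ (a.factorization p + c.factorization p + 1) ∣ a * c := by
        rw [hu, pow_succ]
        exact mul_dvd_mul_left _ (dvd_mul_right p u')
      rw [hp.pow_dvd_iff_le_factorization (by positivity),
        Nat.factorization_mul (by omega) (by omega), Finsupp.add_apply] at hd
      omega
    obtain ⟨i, -, hi⟩ := exists_pos_mul_modEq (pow_pos hp.pos _) hcop
      ((p ^ (Lk k).factorization p - 1) * z)
    refine le_antisymm (Finset.sup_le fun i _ => min_le_right _ _) ?_
    have hmem : i % p ^ (Lk k).factorization p ∈ Finset.range (k + 1) := by
      have h1 := Nat.mod_lt i (pow_pos hp.pos ((Lk k).factorization p))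
      have h2 := pow_factorization_Lk_le p hk
      rw [Finset.mem_range]
      omega
    refine le_trans (le_min ?_ le_rfl) (Finset.le_sup
      (f := fun i => min ((b + a * (n + i * c)).factorization p) N) hmem)
    rw [← hp.pow_dvd_iff_le_factorization (by positivity), hN, ← add_assoc, pow_add]
    have e : b + a * (n + i % p ^ (Lk k).factorization p * c) =
        p ^ (a.factorization p + c.factorization p) *
          (z + u * (i % p ^ (Lk k).factorization p)) := by
      rw [mul_add _ z, ← hz, ← mul_assoc, ← hu]
      ring
    rw [e]
    refine mul_dvd_mul_left _ (Nat.modEq_zero_iff_dvd.1 ?_)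
    refine (((Nat.mod_modEq i _).mul_left u).trans hi).add_left z |>.trans ?_
    refine Nat.modEq_zero_iff_dvd.2 ⟨z, ?_⟩
    have := pow_pos hp.pos ((Lk k).factorization p)
    rw [Nat.sub_mul, one_mul, Nat.add_sub_cancel' (Nat.le_mul_of_pos_left z this)]
  have haT : p ^ (a.factorization p + c.factorization p) ∣ a * T :=
    pow_add p _ _ ▸ mul_dvd_mul (Nat.ordProj_dvd a p) ((pow_dvd_pow p hγ).trans (Nat.ordProj_dvd T p))
  have hsum : ∀ n, 0 < n → p ^ (a.factorization p + c.factorization p) ∣ b + a * n →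
      ∑ i ∈ Finset.range (k + 1), min ((b + a * (n + T + i * c)).factorization p) N =
        ∑ i ∈ Finset.range (k + 1), min ((b + a * (n + i * c)).factorization p) N := by
    intro n hn hd
    have h1 := h n hn
    rw [← localRatio_min_eq (N := N) (totient_prime_pow_ne_zero hp) fun i hi j hj hij =>
        min_factorization_terms_le hp ha hc hi hj hij,
      ← localRatio_min_eq (N := N) (totient_prime_pow_ne_zero hp) fun i hi j hj hij =>
        min_factorization_terms_le hp ha hc hi hj hij] at h1
    have h2 := sum_add_sup_eq_of_localRatio_eq hp hodd h1
    rw [hsup n hn hd, hsup (n + T) (by omega)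
      (by rw [mul_add, ← add_assoc]; exact dvd_add hd haT)] at h2
    omega
  have hshift : ∀ n, ∑ i ∈ Finset.range (k + 1), min ((b + a * (n + i * c)).factorization p) N +
        min ((b + a * (n + (k + 1) * c)).factorization p) N =
      ∑ i ∈ Finset.range (k + 1), min ((b + a * (n + c + i * c)).factorization p) N +
        min ((b + a * n).factorization p) N := by
    intro n
    have e := (Finset.sum_range_succ (fun i => min ((b + a * (n + i * c)).factorization p) N)
      (k + 1)).symm.trans (Finset.sum_range_succ' _ _)
    rw [e]
    congr 1
    · refine Finset.sum_congr rfl fun i _ => ?_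
      rw [show n + (i + 1) * c = n + c + i * c by ring]
    · simp
  obtain ⟨n, hn, hd⟩ := hroot (c.factorization p + (Lk k).factorization p)
  rw [← hN] at hd
  have hd' : p ^ (a.factorization p + c.factorization p) ∣ b + a * n :=
    (pow_dvd_pow p (by omega)).trans hd
  have s1 := hsum n hn hd'
  have s2 := hsum (n + c) (by omega) (by rw [mul_add, ← add_assoc]; exact dvd_add hd' hac)
  have s3 := hshift n
  have s4 := hshift (n + T)
  rw [show n + T + c = n + c + T by ring] at s4
  have v1 : min ((b + a * n).factorization p) N = N :=
    min_eq_right ((hp.pow_dvd_iff_le_factorization (by positivity)).1 hd)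
  have hmod : ∀ m, 0 < m → min ((b + a * (n + m)).factorization p) N =
      min (a.factorization p + m.factorization p) N := fun m hm => by
    have e : b + a * (n + m) = a * m + (b + a * n) := by ring
    rw [min_factorization_eq_of_modEq hp (x := b + a * (n + m)) (y := a * m)
      (N := N) (by positivity) (by positivity)
      (e ▸ (Nat.ModEq.add_left _ (Nat.modEq_zero_iff_dvd.2 hd)).trans (by rfl)),
      Nat.factorization_mul (by omega) (by omega), Finsupp.add_apply]
  have v2 := hmod ((k + 1) * c) (by positivity)
  have v3 := hmod T hT
  have v4 := hmod (T + (k + 1) * c) (by positivity)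
  have v5 : min (T.factorization p) (((k + 1) * c).factorization p) ≤
      (T + (k + 1) * c).factorization p := by
    rw [← hp.pow_dvd_iff_le_factorization (by positivity)]
    exact dvd_add ((pow_dvd_pow p (min_le_left _ _)).trans (Nat.ordProj_dvd _ p))
      ((pow_dvd_pow p (min_le_right _ _)).trans (Nat.ordProj_dvd _ p))
  rw [Nat.factorization_mul (by omega) (by omega), Finsupp.add_apply] at v2 v5
  rw [← add_assoc n T] at v4
  omega

theorem exists_pos_pow_dvd_add_mul {a b p : ℕ} (ha : 1 ≤ a) (hp : p.Prime)
    (h : ¬ p ∣ a / Nat.gcd a b) (M : ℕ) :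
    ∃ n, 0 < n ∧ p ^ (a.factorization p + M) ∣ b + a * n := by
  have hd0 : 0 < Nat.gcd a b := Nat.gcd_pos_of_pos_left b ha
  obtain ⟨a', ha'⟩ := Nat.gcd_dvd_left a b
  obtain ⟨b', hb'⟩ := Nat.gcd_dvd_right a b
  set d := Nat.gcd a b
  rw [ha', Nat.mul_div_cancel_left _ hd0] at h
  have ha0 : a' ≠ 0 := by
    rintro rfl
    simp at h
  obtain ⟨n, hn, hm⟩ := exists_pos_mul_modEq (pow_pos hp.pos M)
    (((Nat.Prime.coprime_iff_not_dvd hp).2 h).symm.pow_right M) ((p ^ M - 1) * b')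
  refine ⟨n, hn, ?_⟩
  have e : b + a * n = d * (b' + a' * n) := by
    rw [hb', ha']
    ring
  have hf : a.factorization p = d.factorization p := by
    rw [ha', Nat.factorization_mul (by omega) ha0, Finsupp.add_apply,
      Nat.factorization_eq_zero_of_not_dvd h, add_zero]
  rw [e, hf, pow_add]
  refine mul_dvd_mul (Nat.ordProj_dvd d p) (Nat.modEq_zero_iff_dvd.1 ?_)
  refine (hm.add_left b').trans (Nat.modEq_zero_iff_dvd.2 ⟨b', ?_⟩)
  rw [Nat.sub_mul, one_mul, Nat.add_sub_cancel' (Nat.le_mul_of_pos_left b' (pow_pos hp.pos M))]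

/-- Formula (4.4): for an odd prime `p` with `p ∣ c L_k` and `p ∤ a'`
(`a' = a / gcd (a, b)`), the `p`-adic valuation of the smallest period
`P_{k,φ}` of `g_{k,φ}` is `v_p (c L_k) − v_p (L_k)` if
`v_p (k + 1) ≥ v_p (L_k) ≥ 1`, and `v_p (c L_k)` otherwise. -/
theorem vp_smallest_period_odd_prime (k a b c : ℕ)
    (hk : 1 ≤ k) (ha : 1 ≤ a) (hc : 1 ≤ c)
    (d a' : ℕ) (hd : d = Nat.gcd a b) (ha' : a' = a / d)
    (p : ℕ) (hp : p.Prime) (hodd : p ≠ 2)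
    (hpdvd : p ∣ c * Lk k) (hpa' : ¬ p ∣ a')
    (P : ℕ)
    (hP : IsLeast {T : ℕ | 0 < T ∧ ∀ n : ℕ, 0 < n →
      gkphi k a b c (n + T) = gkphi k a b c n} P) :
    padicValNat p P =
      if 1 ≤ padicValNat p (Lk k) ∧
          padicValNat p (Lk k) ≤ padicValNat p (k + 1) then
        padicValNat p (c * Lk k) - padicValNat p (Lk k)
      else padicValNat p (c * Lk k) := by
  subst hd ha'
  have hroot := exists_pos_pow_dvd_add_mul ha hp hpa'
  have hL := Lk_ne_zero k
  have hP0 : 0 < P := hP.1.1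
  have hcL : 0 < c * Lk k := by positivity
  simp only [← Nat.factorization_def _ hp]
  have hmul : (c * Lk k).factorization p = c.factorization p + (Lk k).factorization p := by
    rw [Nat.factorization_mul (by omega) hL, Finsupp.add_apply]
  have hupper : P ∣ c * Lk k := dvd_of_isLeast_period hP fun n hn =>
    (gkphi_add_eq_iff_localRatio ha hc hn hcL hp fun _ _ _ => le_rfl).2
      (localRatio_terms_add (totient_prime_pow_ne_zero hp) hp ha hc hn hcL le_rfl)
  have hP1 : P.factorization p ≤ (c * Lk k).factorization p :=
    (Nat.factorization_le_iff_dvd hP0.ne' hcL.ne').2 hupper p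
  obtain ⟨M, hM⟩ := hupper
  have hM0 : M ≠ 0 := by
    rintro rfl
    omega
  set T := P * (M / p ^ M.factorization p) with hTdef
  have hT0 : 0 < T := Nat.mul_pos hP0 (Nat.ordCompl_pos p hM0)
  have hTq : ∀ q, q.Prime → q ≠ p → (c * Lk k).factorization q ≤ T.factorization q := by
    intro q _ hqp
    rw [hM, hTdef, Nat.factorization_mul hP0.ne' hM0,
      Nat.factorization_mul hP0.ne' (Nat.ordCompl_pos p hM0).ne', Nat.factorization_ordCompl,
      Finsupp.add_apply, Finsupp.add_apply, Finsupp.erase_ne hqp]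
  have hTp : T.factorization p = P.factorization p := by
    rw [hTdef, Nat.factorization_mul hP0.ne' (Nat.ordCompl_pos p hM0).ne',
      Nat.factorization_ordCompl, Finsupp.add_apply, Finsupp.erase_same, add_zero]
  have hloc := fun n hn => (gkphi_add_eq_iff_localRatio (b := b) (n := n) ha hc hn hT0 hp hTq).1
    (apply_add_mul_of_period hP.1.2 _ hn)
  split_ifs with hif
  · have hlow := factorization_le_of_localRatio_periodic hk ha hc hp hodd hT0 hroot hloc
    set U := c * Lk k / p ^ (Lk k).factorization p with hUdef
    have hUeq : U = c * (Lk k / p ^ (Lk k).factorization p) :=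
      Nat.mul_div_assoc _ (Nat.ordProj_dvd _ _)
    have hU0 : 0 < U := hUeq ▸ Nat.mul_pos (by omega) (Nat.ordCompl_pos p hL)
    have hUp : U.factorization p = c.factorization p := by
      rw [hUeq, Nat.factorization_mul (by omega) (Nat.ordCompl_pos p hL).ne',
        Nat.factorization_ordCompl, Finsupp.add_apply, Finsupp.erase_same, add_zero]
    have hPU : P ∣ U := dvd_of_isLeast_period hP fun n hn => by
      refine (gkphi_add_eq_iff_localRatio ha hc hn hU0 hp fun q _ hqp => ?_).2
        (localRatio_terms_add_of_le_factorization_succ (totient_prime_pow_ne_zero hp) hp ha hc hn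
          hif.2 (hUeq ▸ (Nat.ordProj_dvd c p).mul_right _))
      rw [hUeq, Nat.factorization_mul (by omega) hL,
        Nat.factorization_mul (by omega) (Nat.ordCompl_pos p hL).ne', Nat.factorization_ordCompl,
        Finsupp.add_apply, Finsupp.add_apply, Finsupp.erase_ne hqp]
    have := (Nat.factorization_le_iff_dvd hP0.ne' hU0.ne').2 hPU p
    omega
  · rcases Nat.eq_zero_or_pos ((Lk k).factorization p) with h0 | h0
    · have hlow := factorization_le_of_localRatio_periodic hk ha hc hp hodd hT0 hroot hloc
      omega
    · have hlow := factorization_mul_Lk_le_of_localRatio_periodic hk ha hc hp hodd hT0 hroot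
        (by omega) hloc
      omega
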